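/- Separable policies are optimal for the two-hop inner problem: let r′ be a rate policy maximizing ∑_{i=1}^N r_i subject to ∑_{i=1}^k f(r_i) ≤ ∑_{i=1}^k E_i and ∑_{i=1}^k φ(r_i) ≤ ∑_{i=1}^k δ_i for all k (the single-user problem with transmitter energies E and receiver energies δ). Then there exist relay rates r̃ ∈ [0,∞)^N such that (r′, r̃) is an optimal solution of the inner problem, i.e., the maximum of the inner problem is attained with source rates equal to r′. -/

import Mathlib

open Finset

/-- Feasibility of a rate policy for the single-user problem with transmitter
energies `E` and receiver energies `Ebar`. -/
def SUFeasible (N : ℕ) (E Ebar : ℕ → ℝ) (f φ : ℝ → ℝ) (r : ℕ → ℝ) : Prop :=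
  (∀ i ∈ Finset.Icc 1 N, 0 ≤ r i) ∧
  (∀ k ∈ Finset.Icc 1 N,
      ∑ i ∈ Finset.Icc 1 k, f (r i) ≤ ∑ i ∈ Finset.Icc 1 k, E i) ∧
  (∀ k ∈ Finset.Icc 1 N,
      ∑ i ∈ Finset.Icc 1 k, φ (r i) ≤ ∑ i ∈ Finset.Icc 1 k, Ebar i)

/-- Feasibility of a pair (source rates `r`, relay rates `rt`) for the two-hop inner
problem with source energies `E`, relay energies `Et`, destination energies `Ebar`,
relay decoding power strategy `δ`, rate-to-power function `f` and decoding cost `φ`. -/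
def InnerFeasible (N : ℕ) (E Et Ebar δ : ℕ → ℝ) (f φ : ℝ → ℝ) (r rt : ℕ → ℝ) : Prop :=
  (∀ i ∈ Finset.Icc 1 N, 0 ≤ r i) ∧
  (∀ i ∈ Finset.Icc 1 N, 0 ≤ rt i) ∧
  (∀ k ∈ Finset.Icc 1 N,
      ∑ i ∈ Finset.Icc 1 k, f (r i) ≤ ∑ i ∈ Finset.Icc 1 k, E i) ∧
  (∀ k ∈ Finset.Icc 1 N,
      ∑ i ∈ Finset.Icc 1 k, φ (r i) ≤ ∑ i ∈ Finset.Icc 1 k, δ i) ∧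
  (∀ k ∈ Finset.Icc 1 N,
      ∑ i ∈ Finset.Icc 1 k, f (rt i) ≤ ∑ i ∈ Finset.Icc 1 k, (Et i - δ i)) ∧
  (∀ k ∈ Finset.Icc 1 N,
      ∑ i ∈ Finset.Icc 1 k, rt i ≤ ∑ i ∈ Finset.Icc 1 k, r i) ∧
  (∀ k ∈ Finset.Icc 1 N,
      ∑ i ∈ Finset.Icc 1 k, φ (rt i) ≤ ∑ i ∈ Finset.Icc 1 k, Ebar i)

lemma aux_sum_update (F : ℝ → ℝ) (r : ℕ → ℝ) (k : ℕ) (hk : 1 ≤ k) (a : ℝ) (j : ℕ) :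
    ∑ i ∈ Finset.Icc 1 j, F (Function.update r k a i)
      = ∑ i ∈ Finset.Icc 1 j, F (r i) + (if k ≤ j then F a - F (r k) else 0) := by
  induction j with
  | zero =>
    have : ¬ k ≤ 0 := by omega
    simp [this]
  | succ j ih =>
    rw [Finset.sum_Icc_succ_top (by omega), Finset.sum_Icc_succ_top (by omega), ih]
    rcases lt_trichotomy k (j+1) with h | h | h
    · rw [if_pos (by omega), if_pos (by omega), Function.update_of_ne (by omega)]; ring
    · subst h
      rw [if_neg (by omega), if_pos le_rfl, Function.update_self]; ring
    · rw [if_neg (by omega), if_neg (by omega), Function.update_of_ne (by omega)]; ring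

/-- Replace entries `k`, `k+1` of `r`. -/
def auxPair (r : ℕ → ℝ) (k : ℕ) (a b : ℝ) : ℕ → ℝ :=
  Function.update (Function.update r k a) (k+1) b

lemma aux_sum_pair (F : ℝ → ℝ) (r : ℕ → ℝ) (k : ℕ) (hk : 1 ≤ k) (a b : ℝ) (j : ℕ) :
    ∑ i ∈ Finset.Icc 1 j, F (auxPair r k a b i)
      = ∑ i ∈ Finset.Icc 1 j, F (r i) + (if k ≤ j then F a - F (r k) else 0)
        + (if k + 1 ≤ j then F b - F (r (k+1)) else 0) := by
  unfold auxPair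
  rw [aux_sum_update _ _ _ (by omega), aux_sum_update _ _ _ hk,
    Function.update_of_ne (by omega)]

lemma aux_pair_nonneg (N : ℕ) (r : ℕ → ℝ) (k : ℕ) (a b : ℝ) (ha : 0 ≤ a) (hb : 0 ≤ b)
    (hr : ∀ i ∈ Finset.Icc 1 N, 0 ≤ r i) :
    ∀ i ∈ Finset.Icc 1 N, 0 ≤ auxPair r k a b i := by
  intro i hi
  unfold auxPair
  by_cases h1 : i = k + 1
  · subst h1; simpa using hb
  · rw [Function.update_of_ne h1]
    by_cases h2 : i = k
    · subst h2; simpa using ha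
    · rw [Function.update_of_ne h2]; exact hr i hi

/-- Prefix constraints survive a pair replacement. -/
lemma aux_pair_constr (N : ℕ) (F : ℝ → ℝ) (r A : ℕ → ℝ) (k : ℕ) (hk : 1 ≤ k)
    (a b : ℝ)
    (hr : ∀ j ∈ Finset.Icc 1 N, ∑ i ∈ Finset.Icc 1 j, F (r i) ≤ A j)
    (h1 : ∑ i ∈ Finset.Icc 1 k, F (r i) + (F a - F (r k)) ≤ A k)
    (h2 : F a + F b ≤ F (r k) + F (r (k+1))) :
    ∀ j ∈ Finset.Icc 1 N, ∑ i ∈ Finset.Icc 1 j, F (auxPair r k a b i) ≤ A j := by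
  intro j hj
  rw [aux_sum_pair F r k hk]
  have := hr j hj
  rcases lt_trichotomy j k with h | h | h
  · rw [if_neg (by omega), if_neg (by omega)]; linarith
  · subst h
    rw [if_pos le_rfl, if_neg (by omega)]; linarith
  · rw [if_pos (by omega), if_pos (by omega)]; linarith

lemma aux_room (f : ℝ → ℝ) (hf : ContinuousOn f (Set.Ici 0)) (b c : ℝ) (hb : 0 ≤ b)
    (h : f b < c) : ∃ ε > 0, ∀ x, 0 ≤ x → x < b + ε → b - ε < x → f x < c := by
  have h1 := (hf b hb).eventually_lt_const h
  rw [eventually_nhdsWithin_iff, Metric.eventually_nhds_iff] at h1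
  obtain ⟨ε, hε, H⟩ := h1
  refine ⟨ε, hε, fun x hx h1 h2 => H ?_ hx⟩
  rw [Real.dist_eq, abs_lt]; constructor <;> linarith

lemma aux_exchange (N : ℕ) (E δ : ℕ → ℝ) (f φ : ℝ → ℝ)
    (hf_cont : ContinuousOn f (Set.Ici 0))
    (hphi_cont : ContinuousOn φ (Set.Ici 0))
    (r : ℕ → ℝ) (hr : SUFeasible N E δ f φ r)
    (hopt : ∀ r₁ : ℕ → ℝ, SUFeasible N E δ f φ r₁ →
        ∑ i ∈ Finset.Icc 1 N, r₁ i ≤ ∑ i ∈ Finset.Icc 1 N, r i)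
    (k : ℕ) (hk : 1 ≤ k) (hkN : k + 1 ≤ N) (a b : ℝ) (ha : 0 ≤ a) (hb : 0 ≤ b)
    (hab : a + b = r k + r (k+1))
    (hf1 : ∑ i ∈ Finset.Icc 1 k, f (r i) + (f a - f (r k)) ≤ ∑ i ∈ Finset.Icc 1 k, E i)
    (hp1 : ∑ i ∈ Finset.Icc 1 k, φ (r i) + (φ a - φ (r k)) ≤ ∑ i ∈ Finset.Icc 1 k, δ i)
    (hf2 : f a + f b < f (r k) + f (r (k+1)))
    (hp2 : φ a + φ b < φ (r k) + φ (r (k+1))) : False := by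
  obtain ⟨e1, he1, H1⟩ := aux_room f hf_cont b (f (r k) + f (r (k+1)) - f a) hb (by linarith)
  obtain ⟨e2, he2, H2⟩ := aux_room φ hphi_cont b (φ (r k) + φ (r (k+1)) - φ a) hb (by linarith)
  have he : 0 < min e1 e2 / 2 := by positivity
  have l1 := min_le_left e1 e2
  have l2 := min_le_right e1 e2
  set e := min e1 e2 / 2 with hedef
  have g1 := H1 (b + e) (by linarith) (by linarith) (by linarith)
  have g2 := H2 (b + e) (by linarith) (by linarith) (by linarith)
  have := hopt (auxPair r k a (b+e)) ⟨aux_pair_nonneg N r k a _ ha (by linarith) hr.1,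
    aux_pair_constr N f r _ k hk a _ hr.2.1 hf1 (by linarith),
    aux_pair_constr N φ r _ k hk a _ hr.2.2 hp1 (by linarith)⟩
  have h3 := aux_sum_pair (fun x => x) r k hk a (b+e) N
  rw [if_pos (by omega), if_pos hkN] at h3
  linarith

lemma aux_avg (f : ℝ → ℝ) (hf : StrictConvexOn ℝ (Set.Ici 0) f) (a b : ℝ) (ha : 0 ≤ a)
    (hb : 0 ≤ b) (hab : a ≠ b) : f ((a+b)/2) + f ((a+b)/2) < f a + f b := by
  have := hf.2 ha hb hab (show (0:ℝ) < 1/2 by norm_num) (show (0:ℝ) < 1/2 by norm_num) (by norm_num)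
  simp only [smul_eq_mul] at this
  rw [show (1/2 * a + 1/2*b : ℝ) = (a+b)/2 by ring] at this
  linarith

lemma aux_shift (f : ℝ → ℝ) (hf : StrictConvexOn ℝ (Set.Ici 0) f) (a b e : ℝ) (ha : 0 ≤ a)
    (he : 0 < e) (hab : e < b - a) : f (a+e) + f (b-e) < f a + f b := by
  have hba : 0 < b - a := by linarith
  have h1 : 0 < e / (b-a) := by positivity
  have h2 : 0 < 1 - e / (b-a) := by
    rw [sub_pos, div_lt_one hba]; exact hab
  have hb : (0:ℝ) ≤ b := by linarith
  have q1 := hf.2 ha hb (by linarith) h2 h1 (by ring)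
  have q2 := hf.2 ha hb (by linarith) h1 h2 (by ring)
  simp only [smul_eq_mul] at q1 q2
  rw [show (1 - e/(b-a)) * a + e/(b-a) * b = a + e by field_simp; ring] at q1
  rw [show e/(b-a) * a + (1 - e/(b-a)) * b = b - e by field_simp; ring] at q2
  nlinarith

lemma aux_mono (N : ℕ) (E δ : ℕ → ℝ) (f φ : ℝ → ℝ)
    (hf_cont : ContinuousOn f (Set.Ici 0))
    (hf_mono : StrictMonoOn f (Set.Ici 0))
    (hf_conv : StrictConvexOn ℝ (Set.Ici 0) f)
    (hphi_cont : ContinuousOn φ (Set.Ici 0))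
    (hphi_mono : StrictMonoOn φ (Set.Ici 0))
    (hphi_conv : StrictConvexOn ℝ (Set.Ici 0) φ)
    (r : ℕ → ℝ) (hr : SUFeasible N E δ f φ r)
    (hopt : ∀ r₁ : ℕ → ℝ, SUFeasible N E δ f φ r₁ →
        ∑ i ∈ Finset.Icc 1 N, r₁ i ≤ ∑ i ∈ Finset.Icc 1 N, r i)
    (k : ℕ) (hk : 1 ≤ k) (hkN : k + 1 ≤ N) : r k ≤ r (k+1) := by
  by_contra! hlt
  have h1 := hr.1 k (by simp; omega)
  have h2 := hr.1 (k+1) (by simp; omega)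
  have hm : (0:ℝ) ≤ (r k + r (k+1))/2 := by positivity
  have m1 := hf_mono hm h1 (by linarith)
  have m2 := hphi_mono hm h1 (by linarith)
  have c1 := hr.2.1 k (by simp; omega)
  have c2 := hr.2.2 k (by simp; omega)
  exact aux_exchange N E δ f φ hf_cont hphi_cont r hr hopt k hk hkN _ _ hm hm (by ring)
    (by linarith) (by linarith) (aux_avg f hf_conv _ _ h1 h2 (by linarith))
    (aux_avg φ hphi_conv _ _ h1 h2 (by linarith))

lemma aux_tight (N : ℕ) (E δ : ℕ → ℝ) (f φ : ℝ → ℝ)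
    (hf_cont : ContinuousOn f (Set.Ici 0))
    (hf_conv : StrictConvexOn ℝ (Set.Ici 0) f)
    (hphi_cont : ContinuousOn φ (Set.Ici 0))
    (hphi_conv : StrictConvexOn ℝ (Set.Ici 0) φ)
    (r : ℕ → ℝ) (hr : SUFeasible N E δ f φ r)
    (hopt : ∀ r₁ : ℕ → ℝ, SUFeasible N E δ f φ r₁ →
        ∑ i ∈ Finset.Icc 1 N, r₁ i ≤ ∑ i ∈ Finset.Icc 1 N, r i)
    (k : ℕ) (hk : 1 ≤ k) (hkN : k + 1 ≤ N)
    (c1 : ∑ i ∈ Finset.Icc 1 k, f (r i) < ∑ i ∈ Finset.Icc 1 k, E i)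
    (c2 : ∑ i ∈ Finset.Icc 1 k, φ (r i) < ∑ i ∈ Finset.Icc 1 k, δ i) : r (k+1) ≤ r k := by
  by_contra! hlt
  have h1 := hr.1 k (by simp; omega)
  obtain ⟨e1, he1, H1⟩ := aux_room f hf_cont (r k)
    (f (r k) + (∑ i ∈ Finset.Icc 1 k, E i - ∑ i ∈ Finset.Icc 1 k, f (r i))) h1 (by linarith)
  obtain ⟨e2, he2, H2⟩ := aux_room φ hphi_cont (r k)
    (φ (r k) + (∑ i ∈ Finset.Icc 1 k, δ i - ∑ i ∈ Finset.Icc 1 k, φ (r i))) h1 (by linarith)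
  obtain ⟨e, he, hlt'⟩ := exists_between
    (show 0 < min (min e1 e2) (r (k+1) - r k) from
      lt_min (lt_min he1 he2) (by linarith))
  rw [lt_min_iff, lt_min_iff] at hlt'
  obtain ⟨⟨l1, l2⟩, l3⟩ := hlt'
  have g1 := H1 (r k + e) (by linarith) (by linarith) (by linarith)
  have g2 := H2 (r k + e) (by linarith) (by linarith) (by linarith)
  exact aux_exchange N E δ f φ hf_cont hphi_cont r hr hopt k hk hkN (r k + e) (r (k+1) - e)
    (by linarith) (by linarith) (by ring)
    (by linarith) (by linarith) (aux_shift f hf_conv _ _ _ h1 he l3)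
    (aux_shift φ hphi_conv _ _ _ h1 he l3)

/-- Subgradients. -/
lemma aux_subgrad (f : ℝ → ℝ) (hf_mono : StrictMonoOn f (Set.Ici 0))
    (hf_conv : StrictConvexOn ℝ (Set.Ici 0) f) (x : ℝ) (hx : 0 ≤ x) :
    ∃ g : ℝ, ∀ y, 0 ≤ y → f x + g * (y - x) ≤ f y := by
  rcases hx.eq_or_lt with h | h
  · subst h
    refine ⟨0, fun y hy => ?_⟩
    have := hf_mono.monotoneOn (Set.mem_Ici.2 le_rfl) hy hy
    linarith
  · let S : Set ℝ := (fun y => (f x - f y) / (x - y)) '' Set.Ico 0 x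
    have hb : ∀ z, x < z → ∀ s ∈ S, s ≤ (f z - f x) / (z - x) := by
      rintro z hz s ⟨y, ⟨hy0, hy⟩, rfl⟩
      exact hf_conv.convexOn.slope_mono_adjacent hy0 (show (0:ℝ) ≤ z by linarith) hy hz
    have hne : S.Nonempty := ⟨_, 0, ⟨le_rfl, h⟩, rfl⟩
    have hbdd : BddAbove S := ⟨_, hb (x+1) (by linarith)⟩
    refine ⟨sSup S, fun y hy => ?_⟩
    rcases lt_trichotomy y x with h1 | h1 | h1
    · have := le_csSup hbdd ⟨y, ⟨hy, h1⟩, rfl⟩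
      simp only at this
      rw [div_le_iff₀ (by linarith)] at this
      linarith
    · subst h1; simp
    · have := csSup_le hne (hb y h1)
      rw [le_div_iff₀ (by linarith)] at this
      linarith

lemma aux_abel (g d : ℕ → ℝ) (k : ℕ) :
    ∑ i ∈ Finset.Icc 1 (k+1), g i * d i
      = g (k+1) * ∑ i ∈ Finset.Icc 1 (k+1), d i
        - ∑ i ∈ Finset.Icc 1 k, (g (i+1) - g i) * ∑ j ∈ Finset.Icc 1 i, d j := by
  induction k with
  | zero => simp
  | succ k ih =>
    rw [Finset.sum_Icc_succ_top (by omega), ih, Finset.sum_Icc_succ_top (b := k + 1) (by omega),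
      Finset.sum_Icc_succ_top (b := k) (by omega),
      Finset.sum_Icc_succ_top (b := k) (by omega),
      Finset.sum_Icc_succ_top (b := k) (by omega)]
    ring

/-- One step of the domination induction. -/
lemma aux_dom_step (ψ : ℝ → ℝ) (hm : StrictMonoOn ψ (Set.Ici 0))
    (hc : StrictConvexOn ℝ (Set.Ici 0) ψ) (r s : ℕ → ℝ) (k : ℕ) 
    (hr : ∀ i ∈ Finset.Icc 1 (k+1), 0 ≤ r i) (hs : ∀ i ∈ Finset.Icc 1 (k+1), 0 ≤ s i)
    (hmono : ∀ i ∈ Finset.Icc 1 k, r i ≤ r (i+1))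
    (hih : ∀ i ∈ Finset.Icc 1 k, r (i+1) = r i ∨
      ∑ j ∈ Finset.Icc 1 i, s j ≤ ∑ j ∈ Finset.Icc 1 i, r j)
    (hle : ∑ i ∈ Finset.Icc 1 (k+1), ψ (s i) ≤ ∑ i ∈ Finset.Icc 1 (k+1), ψ (r i)) :
    ∑ i ∈ Finset.Icc 1 (k+1), s i ≤ ∑ i ∈ Finset.Icc 1 (k+1), r i := by
  have hex : ∀ x : ℝ, ∃ g : ℝ, 0 ≤ x → ∀ y, 0 ≤ y → ψ x + g * (y - x) ≤ ψ y := by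
    intro x
    by_cases hx : 0 ≤ x
    · obtain ⟨g, hg⟩ := aux_subgrad ψ hm hc x hx
      exact ⟨g, fun _ => hg⟩
    · exact ⟨0, fun h => absurd h hx⟩
  choose G hG using hex
  rcases (hr (k+1) (by simp)).eq_or_lt with h0 | hpos
  · have hall : ∀ n, n ≤ k → r (k + 1 - n) ≤ 0 := by
      intro n
      induction n with
      | zero => intro _; simp [← h0]
      | succ n ih =>
        intro hn
        have := hmono (k + 1 - (n+1)) (by simp; omega)
        rw [show k + 1 - (n+1) + 1 = k + 1 - n by omega] at this
        exact this.trans (ih (by omega))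
    have hr0 : ∀ i ∈ Finset.Icc 1 (k+1), r i = 0 := by
      intro i hi
      have h1 := hr i hi
      simp only [Finset.mem_Icc] at hi
      have h2 := hall (k+1-i) (by omega)
      rw [show k + 1 - (k+1-i) = i by omega] at h2
      linarith
    have hge : ∀ i ∈ Finset.Icc 1 (k+1), ψ (r i) ≤ ψ (s i) := by
      intro i hi
      rw [hr0 i hi]
      exact hm.monotoneOn (Set.mem_Ici.2 le_rfl) (hs i hi) (hs i hi)
    have heq := (Finset.sum_eq_sum_iff_of_le hge).1 (le_antisymm (Finset.sum_le_sum hge) hle)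
    apply Finset.sum_le_sum
    intro i hi
    exact (hm.injOn (hr i hi) (hs i hi) (heq i hi)).ge
  · have hGpos : 0 < G (r (k+1)) := by
      have h1 := hG (r (k+1)) hpos.le 0 le_rfl
      have h2 := hm (Set.mem_Ici.2 le_rfl) (Set.mem_Ici.2 hpos.le) hpos
      by_contra! h
      nlinarith
    have hsum : ∑ i ∈ Finset.Icc 1 (k+1), G (r i) * (s i - r i) ≤ 0 := by
      have : ∑ i ∈ Finset.Icc 1 (k+1), (ψ (r i) + G (r i) * (s i - r i))
          ≤ ∑ i ∈ Finset.Icc 1 (k+1), ψ (s i) :=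
        Finset.sum_le_sum fun i hi => hG _ (hr i hi) _ (hs i hi)
      rw [Finset.sum_add_distrib] at this
      linarith
    rw [aux_abel (fun i => G (r i)) (fun i => s i - r i)] at hsum
    have hneg : ∑ i ∈ Finset.Icc 1 k, (G (r (i+1)) - G (r i)) *
        ∑ j ∈ Finset.Icc 1 i, (s j - r j) ≤ 0 := by
      apply Finset.sum_nonpos
      intro i hi
      have hi' := Finset.mem_Icc.1 hi
      rcases hih i hi with h | h
      · rw [h]; simp
      · rw [Finset.sum_sub_distrib]
        apply mul_nonpos_of_nonneg_of_nonpos _ (by linarith)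
        have p1 := hr i (by simp; omega)
        have p2 := hr (i+1) (by simp; omega)
        have q1 := hG _ p1 _ p2
        have q2 := hG _ p2 _ p1
        rcases (hmono i hi).eq_or_lt with h' | h'
        · rw [h']; simp
        · by_contra! hcon
          nlinarith
    have : G (r (k+1)) * ∑ i ∈ Finset.Icc 1 (k+1), (s i - r i) ≤ 0 := by linarith
    have h3 : ∑ i ∈ Finset.Icc 1 (k+1), (s i - r i) ≤ 0 := by
      by_contra! h
      nlinarith [mul_pos hGpos h]
    rw [Finset.sum_sub_distrib] at h3
    linarith

/-- The relaxed relay problem. -/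
def AuxP (N : ℕ) (f φ : ℝ → ℝ) (A B C : ℕ → ℝ) (T : ℕ → Prop) (V : ℝ) (r : ℕ → ℝ) : Prop :=
  (∀ i ∈ Finset.Icc 1 N, 0 ≤ r i) ∧
  (∀ k ∈ Finset.Icc 1 N, ∑ i ∈ Finset.Icc 1 k, f (r i) ≤ A k) ∧
  (∀ k ∈ Finset.Icc 1 N, ∑ i ∈ Finset.Icc 1 k, φ (r i) ≤ B k) ∧
  (∀ k ∈ Finset.Icc 1 N, T k → ∑ i ∈ Finset.Icc 1 k, r i ≤ C k) ∧
  V ≤ ∑ i ∈ Finset.Icc 1 N, r i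

lemma aux_compact (N : ℕ) (hN : 1 ≤ N) (f φ : ℝ → ℝ)
    (hf_cont : ContinuousOn f (Set.Ici 0)) (hphi_cont : ContinuousOn φ (Set.Ici 0))
    (A B C : ℕ → ℝ) (T : ℕ → Prop) (hT : T N) (V : ℝ)
    (hne : ∃ r, AuxP N f φ A B C T V r) (w : ℕ → ℝ) :
    ∃ r, AuxP N f φ A B C T V r ∧ ∀ s, AuxP N f φ A B C T V s →
      ∑ i ∈ Finset.Icc 1 N, w i * s i ≤ ∑ i ∈ Finset.Icc 1 N, w i * r i := by
  have cf : Continuous (fun x => f (max x 0)) :=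
    hf_cont.comp_continuous (by fun_prop) (fun x => Set.mem_Ici.2 (le_max_right _ _))
  have cp : Continuous (fun x => φ (max x 0)) :=
    hphi_cont.comp_continuous (by fun_prop) (fun x => Set.mem_Ici.2 (le_max_right _ _))
  let K : Set (ℕ → ℝ) := Set.pi Set.univ
    (fun i => Set.Icc 0 (if i ∈ Finset.Icc 1 N then C N else 0))
  have hK : IsCompact K := isCompact_univ_pi fun i => isCompact_Icc
  let Q : Set (ℕ → ℝ) := {r | (∀ k ∈ Finset.Icc 1 N, ∑ i ∈ Finset.Icc 1 k, f (max (r i) 0) ≤ A k) ∧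
    (∀ k ∈ Finset.Icc 1 N, ∑ i ∈ Finset.Icc 1 k, φ (max (r i) 0) ≤ B k) ∧
    (∀ k ∈ Finset.Icc 1 N, T k → ∑ i ∈ Finset.Icc 1 k, r i ≤ C k) ∧
    V ≤ ∑ i ∈ Finset.Icc 1 N, r i}
  have hQ : IsClosed Q := by
    have e1 : ∀ i : ℕ, Continuous (fun r : ℕ → ℝ => f (max (r i) 0)) := fun i =>
      cf.comp (continuous_apply i)
    have e2 : ∀ i : ℕ, Continuous (fun r : ℕ → ℝ => φ (max (r i) 0)) := fun i =>
      cp.comp (continuous_apply i)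
    simp only [Q, Set.ofPred_and, Set.ofPred_forall]
    refine IsClosed.inter ?_ (IsClosed.inter ?_ (IsClosed.inter ?_ ?_))
    · exact isClosed_iInter fun k => isClosed_iInter fun _ =>
        isClosed_le (continuous_finsetSum _ fun i _ => e1 i) continuous_const
    · exact isClosed_iInter fun k => isClosed_iInter fun _ =>
        isClosed_le (continuous_finsetSum _ fun i _ => e2 i) continuous_const
    · exact isClosed_iInter fun k => isClosed_iInter fun _ => isClosed_iInter fun _ =>
        isClosed_le (by fun_prop) continuous_const
    · exact isClosed_le continuous_const (by fun_prop)
  have htr : ∀ s, AuxP N f φ A B C T V s →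
      (fun i => if i ∈ Finset.Icc 1 N then s i else 0) ∈ K ∩ Q := by
    rintro s ⟨h0, h1, h2, h3, h4⟩
    have hsum : ∀ (F : ℝ → ℝ), ∀ k ∈ Finset.Icc 1 N,
        ∑ i ∈ Finset.Icc 1 k, F (if i ∈ Finset.Icc 1 N then s i else 0)
          = ∑ i ∈ Finset.Icc 1 k, F (s i) := by
      intro F k hk
      apply Finset.sum_congr rfl
      intro i hi
      rw [if_pos]
      simp only [Finset.mem_Icc] at hi hk ⊢; omega
    have hmax : ∀ (F : ℝ → ℝ), ∀ k ∈ Finset.Icc 1 N,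
        ∑ i ∈ Finset.Icc 1 k, F (max (s i) 0) = ∑ i ∈ Finset.Icc 1 k, F (s i) := by
      intro F k hk
      apply Finset.sum_congr rfl
      intro i hi
      rw [max_eq_left (h0 i _)]
      simp only [Finset.mem_Icc] at hi hk ⊢; omega
    have hNm : N ∈ Finset.Icc 1 N := by simp; omega
    refine ⟨?_, ?_, ?_, ?_, ?_⟩
    · intro i _
      by_cases hi : i ∈ Finset.Icc 1 N
      · simp only [if_pos hi]
        exact ⟨h0 i hi, (Finset.single_le_sum h0 hi).trans (h3 N hNm hT)⟩
      · simp only [if_neg hi]; simp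
    · intro k hk
      rw [hsum (fun x => f (max x 0)) k hk, hmax f k hk]; exact h1 k hk
    · intro k hk
      rw [hsum (fun x => φ (max x 0)) k hk, hmax φ k hk]; exact h2 k hk
    · intro k hk hTk
      rw [hsum (fun x => x) k hk]; exact h3 k hk hTk
    · rw [hsum (fun x => x) N hNm]; exact h4
  obtain ⟨s0, hs0⟩ := hne
  obtain ⟨r, ⟨hrK, hrQ⟩, hmax⟩ := (hK.inter_right hQ).exists_isMaxOn ⟨_, htr s0 hs0⟩
    (f := fun r : ℕ → ℝ => ∑ i ∈ Finset.Icc 1 N, w i * r i) (by fun_prop)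
  have hr0 : ∀ i, 0 ≤ r i := fun i => (hrK i (Set.mem_univ i)).1
  obtain ⟨h1, h2, h3, h4⟩ := hrQ
  refine ⟨r, ⟨fun i _ => hr0 i, ?_, ?_, h3, h4⟩, ?_⟩
  · simpa only [max_eq_left (hr0 _)] using h1
  · simpa only [max_eq_left (hr0 _)] using h2
  · intro s hs
    have := hmax (htr s hs)
    simp only [Set.mem_ofPred_eq] at this
    refine le_trans (le_of_eq ?_) this
    apply Finset.sum_congr rfl
    intro i hi
    rw [if_pos hi]

/-- separable policies are optimal for the two-hop inner problem; the
inner problem's maximum is attained with source rates equal to an optimal single-user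
policy `r'` for transmitter energies `E` and receiver energies `δ`. -/
theorem twohop_inner_separable_optimal
    (N : ℕ) (hN : 1 ≤ N)
    (E Et Ebar δ : ℕ → ℝ)
    (hE : ∀ i ∈ Finset.Icc 1 N, 0 ≤ E i)
    (hEt : ∀ i ∈ Finset.Icc 1 N, 0 ≤ Et i)
    (hEbar : ∀ i ∈ Finset.Icc 1 N, 0 ≤ Ebar i)
    (hδ : ∀ i ∈ Finset.Icc 1 N, 0 ≤ δ i)
    (hδEt : ∀ k ∈ Finset.Icc 1 N,
        ∑ i ∈ Finset.Icc 1 k, δ i ≤ ∑ i ∈ Finset.Icc 1 k, Et i)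
    (f φ : ℝ → ℝ)
    (hf_cont : ContinuousOn f (Set.Ici 0))
    (hf_mono : StrictMonoOn f (Set.Ici 0))
    (hf_conv : StrictConvexOn ℝ (Set.Ici 0) f)
    (hf_nonneg : ∀ x : ℝ, 0 ≤ x → 0 ≤ f x)
    (hf0 : f 0 = 0)
    (hphi_cont : ContinuousOn φ (Set.Ici 0))
    (hphi_mono : StrictMonoOn φ (Set.Ici 0))
    (hphi_conv : StrictConvexOn ℝ (Set.Ici 0) φ)
    (hphi_nonneg : ∀ x : ℝ, 0 ≤ x → 0 ≤ φ x)
    (hphi0 : φ 0 = 0)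
    (r' : ℕ → ℝ)
    (hr'_feas : SUFeasible N E δ f φ r')
    (hr'_opt : ∀ r : ℕ → ℝ, SUFeasible N E δ f φ r →
        ∑ i ∈ Finset.Icc 1 N, r i ≤ ∑ i ∈ Finset.Icc 1 N, r' i) :
    ∃ rt : ℕ → ℝ,
      InnerFeasible N E Et Ebar δ f φ r' rt ∧
      (∀ r'' rt' : ℕ → ℝ, InnerFeasible N E Et Ebar δ f φ r'' rt' →
          ∑ i ∈ Finset.Icc 1 N, rt' i ≤ ∑ i ∈ Finset.Icc 1 N, rt i) := by
  classical
  let T : ℕ → Prop := fun k => k = N ∨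
    ∑ i ∈ Finset.Icc 1 k, f (r' i) = ∑ i ∈ Finset.Icc 1 k, E i ∨
    ∑ i ∈ Finset.Icc 1 k, φ (r' i) = ∑ i ∈ Finset.Icc 1 k, δ i
  have hmono : ∀ k, 1 ≤ k → k + 1 ≤ N → r' k ≤ r' (k+1) := fun k h1 h2 =>
    aux_mono N E δ f φ hf_cont hf_mono hf_conv hphi_cont hphi_mono hphi_conv r' hr'_feas
      hr'_opt k h1 h2
  have htight : ∀ k, 1 ≤ k → k + 1 ≤ N → ¬ T k → r' (k+1) ≤ r' k := by
    intro k h1 h2 hk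
    simp only [T, not_or] at hk
    have hkm : k ∈ Finset.Icc 1 N := by simp; omega
    exact aux_tight N E δ f φ hf_cont hf_conv hphi_cont hphi_conv r' hr'_feas
      hr'_opt k h1 h2 (lt_of_le_of_ne (hr'_feas.2.1 k hkm) hk.2.1)
      (lt_of_le_of_ne (hr'_feas.2.2 k hkm) hk.2.2)
  have hdom : ∀ s, SUFeasible N E δ f φ s → ∀ k ∈ Finset.Icc 1 N, T k →
      ∑ i ∈ Finset.Icc 1 k, s i ≤ ∑ i ∈ Finset.Icc 1 k, r' i := by
    intro s hs k
    induction k using Nat.strong_induction_on with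
    | _ k ih =>
      intro hk hTk
      have hk' := Finset.mem_Icc.1 hk
      obtain ⟨m, rfl⟩ : ∃ m, k = m + 1 := ⟨k - 1, by omega⟩
      have a1 : ∀ i ∈ Finset.Icc 1 (m+1), 0 ≤ r' i := fun i hi => hr'_feas.1 i (by
        simp only [Finset.mem_Icc] at hi ⊢; omega)
      have a2 : ∀ i ∈ Finset.Icc 1 (m+1), 0 ≤ s i := fun i hi => hs.1 i (by
        simp only [Finset.mem_Icc] at hi ⊢; omega)
      have a3 : ∀ i ∈ Finset.Icc 1 m, r' i ≤ r' (i+1) := fun i hi => by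
        simp only [Finset.mem_Icc] at hi
        exact hmono i hi.1 (by omega)
      have a4 : ∀ i ∈ Finset.Icc 1 m, r' (i+1) = r' i ∨
          ∑ j ∈ Finset.Icc 1 i, s j ≤ ∑ j ∈ Finset.Icc 1 i, r' j := by
        intro i hi
        have hi' := Finset.mem_Icc.1 hi
        by_cases hTi : T i
        · exact Or.inr (ih i (by omega) (by simp; omega) hTi)
        · exact Or.inl (le_antisymm (htight i hi'.1 (by omega) hTi) (a3 i hi))
      rcases hTk with h | h | h
      · rw [h]; exact hr'_opt s hs
      · exact aux_dom_step f hf_mono hf_conv r' s m a1 a2 a3 a4 (h ▸ hs.2.1 _ hk)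
      · exact aux_dom_step φ hphi_mono hphi_conv r' s m a1 a2 a3 a4 (h ▸ hs.2.2 _ hk)
  have hTN : T N := Or.inl rfl
  let A : ℕ → ℝ := fun k => ∑ i ∈ Finset.Icc 1 k, (Et i - δ i)
  let B : ℕ → ℝ := fun k => ∑ i ∈ Finset.Icc 1 k, Ebar i
  let C : ℕ → ℝ := fun k => ∑ i ∈ Finset.Icc 1 k, r' i
  have hsub : ∀ k ∈ Finset.Icc 1 N, ∀ i ∈ Finset.Icc 1 k, i ∈ Finset.Icc 1 N := by
    intro k hk i hi
    simp only [Finset.mem_Icc] at hi hk ⊢; omega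
  have hzero : AuxP N f φ A B C T 0 (fun _ => 0) := by
    refine ⟨fun _ _ => le_rfl, ?_, ?_, ?_, by simp⟩
    · intro k hk
      simp only [hf0, Finset.sum_const_zero, A, Finset.sum_sub_distrib]
      linarith [hδEt k hk]
    · intro k hk
      simp only [hphi0, Finset.sum_const_zero, B]
      exact Finset.sum_nonneg fun i hi => hEbar i (hsub k hk i hi)
    · intro k hk _
      simp only [Finset.sum_const_zero, C]
      exact Finset.sum_nonneg fun i hi => hr'_feas.1 i (hsub k hk i hi)
  obtain ⟨s, hs, hsmax⟩ := aux_compact N hN f φ hf_cont hphi_cont A B C T hTN 0 ⟨_, hzero⟩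
    (fun _ => 1)
  simp only [one_mul] at hsmax
  obtain ⟨t, ht, htmax⟩ := aux_compact N hN f φ hf_cont hphi_cont A B C T hTN
    (∑ i ∈ Finset.Icc 1 N, s i) ⟨s, hs.1, hs.2.1, hs.2.2.1, hs.2.2.2.1, le_rfl⟩
    (fun i => (i : ℝ))
  obtain ⟨t0, t1, t2, t3, t4⟩ := ht
  have hup : ∀ k, 1 ≤ k → k + 1 ≤ N → ¬ T k → t k ≤ t (k+1) := by
    intro k hk hkN hTk
    by_contra! hlt
    have hkm : k ∈ Finset.Icc 1 N := by simp; omega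
    have p1 := t0 k hkm
    have p2 := t0 (k+1) (by simp; omega)
    have hm : (0:ℝ) ≤ (t k + t (k+1))/2 := by positivity
    have m1 := hf_mono hm p1 (by linarith)
    have m2 := hphi_mono hm p1 (by linarith)
    have s1 := aux_sum_pair (fun x => x) t k hk ((t k + t (k+1))/2) ((t k + t (k+1))/2)
    have hfe : AuxP N f φ A B C T (∑ i ∈ Finset.Icc 1 N, s i)
        (auxPair t k ((t k + t (k+1))/2) ((t k + t (k+1))/2)) := by
      refine ⟨aux_pair_nonneg N t k _ _ hm hm t0,
        aux_pair_constr N f t A k hk _ _ t1 (by linarith [t1 k hkm])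
          (aux_avg f hf_conv _ _ p1 p2 (by linarith)).le,
        aux_pair_constr N φ t B k hk _ _ t2 (by linarith [t2 k hkm])
          (aux_avg φ hphi_conv _ _ p1 p2 (by linarith)).le, ?_, ?_⟩
      · intro j hj hTj
        have hjk : j ≠ k := by rintro rfl; exact hTk hTj
        rw [s1]
        have := t3 j hj hTj
        rcases lt_or_gt_of_ne hjk with h | h
        · rw [if_neg (by omega), if_neg (by omega)]; linarith
        · rw [if_pos (by omega), if_pos (by omega)]; linarith
      · rw [s1, if_pos (by omega), if_pos (by omega)]; linarith
    have hmx := htmax _ hfe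
    have h1 : ∑ i ∈ Finset.Icc 1 N,
        ((i:ℝ) * auxPair t k ((t k + t (k+1))/2) ((t k + t (k+1))/2) i - (i:ℝ) * t i)
        = (k:ℝ) * ((t k + t (k+1))/2 - t k) + ((k+1 : ℕ):ℝ) * ((t k + t (k+1))/2 - t (k+1)) := by
      rw [← Finset.sum_subset (s₁ := {k, k+1})]
      · rw [Finset.sum_pair (by omega)]
        unfold auxPair
        rw [Function.update_of_ne (by omega), Function.update_self, Function.update_self]
        ring
      · intro i hi
        simp only [Finset.mem_insert, Finset.mem_singleton] at hi
        simp only [Finset.mem_Icc]; omega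
      · intro i _ hi
        simp only [Finset.mem_insert, Finset.mem_singleton, not_or] at hi
        unfold auxPair
        rw [Function.update_of_ne hi.2, Function.update_of_ne hi.1]; ring
    rw [Finset.sum_sub_distrib] at h1
    push_cast at h1
    linarith
  have hcaus : ∀ k ∈ Finset.Icc 1 N,
      ∑ i ∈ Finset.Icc 1 k, t i ≤ ∑ i ∈ Finset.Icc 1 k, r' i := by
    have key : ∀ k, 1 ≤ k → (C k < ∑ i ∈ Finset.Icc 1 k, t i) → r' k ≤ t k →
        ∀ n, k + n ≤ N → (C (k+n) < ∑ i ∈ Finset.Icc 1 (k+n), t i) ∧ r' (k+n) ≤ t (k+n) := by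
      intro k hk h1 h2 n
      induction n with
      | zero => intro _; exact ⟨h1, h2⟩
      | succ n ih =>
        intro hn
        obtain ⟨q1, q2⟩ := ih (by omega)
        have hnT : ¬ T (k+n) := fun h => by
          have := t3 (k+n) (by simp; omega) h
          linarith
        have u1 := hup (k+n) (by omega) (by omega) hnT
        have u2 := htight (k+n) (by omega) (by omega) hnT
        have u3 : r' (k+n+1) ≤ t (k+n+1) := by linarith
        refine ⟨?_, u3⟩
        simp only [C] at q1 ⊢
        rw [← add_assoc, Finset.sum_Icc_succ_top (by omega), Finset.sum_Icc_succ_top (by omega)]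
        linarith
    intro k
    induction k with
    | zero => intro h; simp at h
    | succ k ih =>
      intro hk
      have hk' := Finset.mem_Icc.1 hk
      by_contra! hlt
      have hprev : ∑ i ∈ Finset.Icc 1 k, t i ≤ ∑ i ∈ Finset.Icc 1 k, r' i := by
        rcases Nat.eq_zero_or_pos k with h | h
        · subst h; simp
        · exact ih (by simp; omega)
      have hinc : r' (k+1) ≤ t (k+1) := by
        have hlt2 := hlt
        rw [Finset.sum_Icc_succ_top (by omega), Finset.sum_Icc_succ_top (by omega)] at hlt2
        linarith
      have := (key (k+1) (by omega) hlt hinc (N - (k+1)) (by omega)).1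
      rw [show k + 1 + (N - (k+1)) = N by omega] at this
      have := t3 N (by simp; omega) hTN
      linarith
  refine ⟨t, ⟨hr'_feas.1, t0, hr'_feas.2.1, hr'_feas.2.2, t1, hcaus, t2⟩, ?_⟩
  rintro r2 t' ⟨b1, b2, b3, b4, b5, b6, b7⟩
  refine le_trans (hsmax t' ⟨b2, b5, b7, ?_, Finset.sum_nonneg b2⟩) t4
  intro k hk hTk
  exact (b6 k hk).trans (hdom r2 ⟨b1, b3, b4⟩ k hk hTk)
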